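/- Let (R,𝔪) be a Noetherian local ring which is generalized Cohen–Macaulay (i.e., 𝔪^n H^i_𝔪(R) = 0 for some n and all i < dim R). Then for every prime ideal 𝔭 of R, the quotient R/𝔭 has a uniform local cohomological annihilator. -/

import Mathlib

noncomputable section
open CategoryTheory

namespace Paper

variable (R : Type) [CommRing R]

/-- The `i`-th local cohomology of the `R`-module `M` with respect to the ideal `I`. -/
abbrev H (I : Ideal R) (i : ℕ) (M : Type) [AddCommGroup M] [Module R M] : ModuleCat R :=
  (localCohomology I i).obj (ModuleCat.of R M)

/-- `N` is a `p`-secondary submodule of `M`: it is nonzero, every `r : R` acts on it either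
surjectively or nilpotently, and `p` is the radical of its annihilator. -/
def IsSecondaryFor {M : Type} [AddCommGroup M] [Module R M]
    (N : Submodule R M) (p : Ideal R) : Prop :=
  N ≠ ⊥ ∧
  (∀ r : R, (∀ m ∈ N, ∃ n ∈ N, r • n = m) ∨ (∃ k : ℕ, ∀ m ∈ N, r ^ k • m = 0)) ∧
  N.annihilator.radical = p

/-- A minimal secondary representation of the module `M`. -/
structure MinSecRep (M : Type) [AddCommGroup M] [Module R M] where
  n : ℕ
  S : Fin n → Submodule R M
  p : Fin n → Ideal R
  prime : ∀ i, (p i).IsPrime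
  sec : ∀ i, IsSecondaryFor R (S i) (p i)
  sum : (⨆ i, S i) = ⊤
  inj : Function.Injective p
  irred : ∀ j, ¬ (S j ≤ ⨆ i ∈ ({j}ᶜ : Set (Fin n)), S i)

/-- `M` is representable: it is a (finite) sum of secondary submodules. -/
def IsRepresentable (M : Type) [AddCommGroup M] [Module R M] : Prop :=
  ∃ (n : ℕ) (S : Fin n → Submodule R M) (p : Fin n → Ideal R),
    (∀ i, (p i).IsPrime) ∧ (∀ i, IsSecondaryFor R (S i) (p i)) ∧ (⨆ i, S i) = ⊤

/-- The set of attached primes of `M`: the primes occurring in a minimal secondary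
representation of `M`. -/
def attached (M : Type) [AddCommGroup M] [Module R M] : Set (Ideal R) :=
  {q | ∃ (rep : MinSecRep R M) (i : Fin rep.n), rep.p i = q}

/-- The coheight (dimension of `R/I`): Krull dimension of the set of primes containing `I`. -/
def coheight (I : Ideal R) : WithBot ℕ∞ :=
  Order.krullDim {p : Ideal R // p.IsPrime ∧ I ≤ p}

/-- The Krull dimension of the ring `R`. -/
def ringDim : WithBot ℕ∞ := Order.krullDim {p : Ideal R // p.IsPrime}

/-- The Krull dimension of (the support of) the finitely generated module `M`. -/
def dimMod (M : Type) [AddCommGroup M] [Module R M] : WithBot ℕ∞ :=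
  coheight R (Module.annihilator R M)

/-- The dimension of the localized module `M_q`: chains of primes in the support of `M`
contained in `q`. -/
def dimModAt (M : Type) [AddCommGroup M] [Module R M] (q : Ideal R) : WithBot ℕ∞ :=
  Order.krullDim {p : Ideal R // p.IsPrime ∧ Module.annihilator R M ≤ p ∧ p ≤ q}

/-- The support of a finitely generated module: primes containing the annihilator. -/
def supp (M : Type) [AddCommGroup M] [Module R M] : Set (Ideal R) :=
  {p | p.IsPrime ∧ Module.annihilator R M ≤ p}

/-- `Min M`: minimal primes of the support of `M`. -/
def minSupp (M : Type) [AddCommGroup M] [Module R M] : Set (Ideal R) :=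
  (Module.annihilator R M).minimalPrimes

/-- `Assh M`: primes in the support of maximal coheight. -/
def assh (M : Type) [AddCommGroup M] [Module R M] : Set (Ideal R) :=
  {p | p ∈ supp R M ∧ coheight R p = dimMod R M}

open RingTheory.Sequence in
/-- Depth of `M` with respect to the ideal `J`: supremum of the lengths of `M`-regular
sequences contained in `J`. -/
def depthOn (J : Ideal R) (M : Type) [AddCommGroup M] [Module R M] : ℕ∞ :=
  ⨆ l ∈ {l : List R | (∀ x ∈ l, x ∈ J) ∧ IsRegular M l}, (l.length : ℕ∞)

/-- `M` is a Cohen–Macaulay module over the local ring `R`: depth = dimension. -/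
def IsCMLocalMod [IsLocalRing R] (M : Type) [AddCommGroup M] [Module R M] : Prop :=
  (depthOn R (IsLocalRing.maximalIdeal R) M : WithBot ℕ∞) = dimMod R M

/-- `R` is a Cohen–Macaulay local ring: it is local and its depth (w.r.t. its Jacobson
radical, which is the maximal ideal) equals its Krull dimension. -/
def IsCMLocalRing : Prop :=
  IsLocalRing R ∧ ((depthOn R ((⊥ : Ideal R).jacobson) R : WithBot ℕ∞) = ringDim R)

/-- `R` is a Cohen–Macaulay ring: all of its localizations at primes are CM local rings. -/
def IsCMRing : Prop :=
  ∀ (p : Ideal R) [p.IsPrime], IsCMLocalRing (Localization.AtPrime p)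

/-- `M` is an equidimensional module: every minimal prime of its support has coheight equal
to the dimension of `M`. -/
def IsEquidim (M : Type) [AddCommGroup M] [Module R M] : Prop :=
  ∀ q ∈ minSupp R M, coheight R q = dimMod R M

/-- `R` is catenary: any two saturated chains of primes with the same endpoints have the
same length. -/
def IsCatenary : Prop :=
  ∀ (c₁ c₂ : LTSeries {p : Ideal R // p.IsPrime}),
    c₁.head = c₂.head → c₁.last = c₂.last →
    (∀ i : Fin c₁.length, c₁.toFun i.castSucc ⋖ c₁.toFun i.succ) →
    (∀ i : Fin c₂.length, c₂.toFun i.castSucc ⋖ c₂.toFun i.succ) →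
    c₁.length = c₂.length

/-- `R` is universally catenary: every finitely generated `R`-algebra is catenary. -/
def IsUnivCatenary : Prop :=
  ∀ (A : Type) [CommRing A] [Algebra R A], Algebra.FiniteType R A → IsCatenary A

/-- `x` is a uniform local cohomological annihilator of `M`: `x` avoids all minimal primes
of `M` and, for every maximal ideal `m`, kills `H^i_m(M)` for all `i < dim M_m`. -/
def IsULCA (M : Type) [AddCommGroup M] [Module R M] (x : R) : Prop :=
  (∀ p ∈ minSupp R M, x ∉ p) ∧
  ∀ (m : Ideal R), m.IsMaximal → ∀ i : ℕ, (i : WithBot ℕ∞) < dimModAt R M m →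
    ∀ y : H R m i M, x • y = 0

/-- `M` has a uniform local cohomological annihilator. -/
def HasULCA (M : Type) [AddCommGroup M] [Module R M] : Prop := ∃ x, IsULCA R M x

/-- `R/p` has a uniform local cohomological annihilator (local case): some `x ∉ p` kills
`H^i_𝔪(R/p)` for all `i < dim R/p`. -/
def HasULCAQuot [IsLocalRing R] (p : Ideal R) : Prop :=
  ∃ x ∉ p, ∀ i : ℕ, (i : WithBot ℕ∞) < coheight R p →
    ∀ y : H R (IsLocalRing.maximalIdeal R) i (R ⧸ p), x • y = 0

/-- `M` is generalized Cohen–Macaulay over the local ring `R`: a power of the maximal ideal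
kills all local cohomology below the dimension. -/
def IsGCM [IsLocalRing R] (M : Type) [AddCommGroup M] [Module R M] : Prop :=
  ∃ n : ℕ, ∀ i : ℕ, (i : WithBot ℕ∞) < dimMod R M →
    ∀ a ∈ (IsLocalRing.maximalIdeal R) ^ n,
      ∀ y : H R (IsLocalRing.maximalIdeal R) i M, a • y = 0

end Paper

universe u

namespace ExtComparison
open Opposite
variable {R : Type u} [CommRing R]

section Complex

variable {K L : ChainComplex (ModuleCat.{u} R)ᵒᵖ ℕ} {n : ℕ}

lemma homologyι_unop_surjective : Function.Surjective (K.homologyι n).unop := by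
  rw [← ModuleCat.epi_iff_surjective]
  exact unop_epi_of_mono _

lemma homologyι_zero_unop_injective : Function.Injective (K.homologyι 0).unop := by
  rw [← ModuleCat.mono_iff_injective]
  exact unop_mono_of_epi _

lemma pOpcycles_unop_injective : Function.Injective (K.pOpcycles n).unop := by
  rw [← ModuleCat.mono_iff_injective]
  exact unop_mono_of_epi _

lemma d_unop_pOpcycles_unop (m : ℕ) (z) : (K.d m n).unop ((K.pOpcycles n).unop z) = 0 :=
  congrArg (fun f => f.hom z) (congrArg Quiver.Hom.unop (K.d_pOpcycles m n))

lemma exists_pOpcycles_unop_eq (f : (K.X n).unop) (m : ℕ) (hm : n + 1 = m)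
    (hf : (K.d m n).unop f = 0) : ∃ z, (K.pOpcycles n).unop z = f := by
  let k : K.X n ⟶ op (ModuleCat.of R R) :=
    Quiver.Hom.op (ModuleCat.ofHom (LinearMap.toSpanSingleton R (K.X n).unop f))
  have hk : K.d m n ≫ k = 0 := by
    apply Quiver.Hom.unop_inj
    apply ModuleCat.hom_ext
    apply LinearMap.ext_ring
    change (K.d m n).unop ((1 : R) • f) = 0
    rw [one_smul, hf]
  have h := congrArg Quiver.Hom.unop (K.p_descOpcycles k m (by subst hm; simp) hk)
  refine ⟨(K.descOpcycles k m (by subst hm; simp) hk).unop (1 : R), ?_⟩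
  exact (congrArg (fun f => f.hom (1 : R)) h).trans (one_smul R f)

lemma homologyι_unop_eq_zero_iff (z) (p : ℕ) (hp : p + 1 = n) :
    (K.homologyι n).unop z = 0 ↔ ∃ g, (K.d n p).unop g = (K.pOpcycles n).unop z := by
  have hex : (ShortComplex.mk _ _ (K.homologyι_comp_fromOpcycles n p)).Exact :=
    ShortComplex.exact_of_f_is_kernel _ (K.homologyIsKernel n p (by subst hp; simp))
  have hex' := (ShortComplex.ShortExact.moduleCat_exact_iff_function_exact _).1 hex.unop
  have hpf := congrArg Quiver.Hom.unop (K.p_fromOpcycles n p)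
  refine (hex' z).trans ⟨?_, ?_⟩
  · rintro ⟨g, rfl⟩
    exact ⟨g, (congrArg (fun f => f.hom g) hpf).symm⟩
  · rintro ⟨g, hg⟩
    exact ⟨g, pOpcycles_unop_injective ((congrArg (fun f => f.hom g) hpf).trans hg)⟩

lemma homologyMap_unop_homologyι_unop (ψ : L ⟶ K) (z) (z')
    (h : (L.pOpcycles n).unop z' = (ψ.f n).unop ((K.pOpcycles n).unop z)) :
    (HomologicalComplex.homologyMap ψ n).unop ((K.homologyι n).unop z) =
      (L.homologyι n).unop z' := by
  have hz : (HomologicalComplex.opcyclesMap ψ n).unop z = z' := by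
    apply pOpcycles_unop_injective
    rw [h]
    exact congrArg (fun f => f.hom z)
      (congrArg Quiver.Hom.unop (HomologicalComplex.p_opcyclesMap ψ n))
  rw [← hz]
  exact congrArg (fun f => f.hom z)
    (congrArg Quiver.Hom.unop (HomologicalComplex.homologyι_naturality ψ n))

end Complex

variable {X : ModuleCat.{u} R} (P : ProjectiveResolution X) (Y : ModuleCat.{u} R) (n : ℕ)

/-- The complex `Hom(P, Y)`, viewed in the opposite category of modules. -/
def homComplex : ChainComplex (ModuleCat.{u} R)ᵒᵖ ℕ :=
  (((linearYoneda R (ModuleCat.{u} R)).obj Y).rightOp.mapHomologicalComplex _).obj P.complex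

/-- The derived functor `Ext` is the homology of `Hom(P, Y)`. -/
def extIso : (homComplex P Y).homology n ≅
    op (((_root_.Ext R (ModuleCat.{u} R) n).obj (op X)).obj Y) :=
  (P.isoLeftDerivedObj ((linearYoneda R (ModuleCat.{u} R)).obj Y).rightOp n).symm

lemma extIso_unop_bijective : Function.Bijective (extIso P Y n).hom.unop :=
  ConcreteCategory.bijective_of_isIso _

lemma extIso_naturality {X' : ModuleCat.{u} R} {P' : ProjectiveResolution X'}
    (g : X' ⟶ X) (φ : ProjectiveResolution.Hom P' P g) (e) :
    (extIso P' Y n).hom.unop (((_root_.Ext R (ModuleCat.{u} R) n).map g.op).app Y e) =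
      (HomologicalComplex.homologyMap
        ((((linearYoneda R (ModuleCat.{u} R)).obj Y).rightOp.mapHomologicalComplex
          (ComplexShape.down ℕ)).map φ.hom) n).unop ((extIso P Y n).hom.unop e) := by
  have h1 := P'.isoLeftDerivedObj_inv_naturality g P φ.hom φ.hom_f_zero_comp_π_f_zero
    ((linearYoneda R (ModuleCat.{u} R)).obj Y).rightOp n
  exact congrArg (fun f => f.hom e) (congrArg Quiver.Hom.unop h1)

/-- A class `e` of the derived functor `Ext` is represented by the cocycle `f`. -/
def IsRep (e : ((_root_.Ext R (ModuleCat.{u} R) n).obj (op X)).obj Y)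
    (f : P.complex.X n ⟶ Y) : Prop :=
  ∃ z, (extIso P Y n).hom.unop e = ((homComplex P Y).homologyι n).unop z ∧
    ((homComplex P Y).pOpcycles n).unop z = f

variable {P Y n}

lemma IsRep.smul {e f} (h : IsRep P Y n e f) (r : R) : IsRep P Y n (r • e) (r • f) := by
  obtain ⟨z, h1, rfl⟩ := h
  exact ⟨r • z, by rw [map_smul, map_smul, h1], map_smul _ _ _⟩

lemma exists_isRep (e) : ∃ f, IsRep P Y n e f :=
  have ⟨z, hz⟩ := homologyι_unop_surjective ((extIso P Y n).hom.unop e)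
  ⟨_, z, hz.symm, rfl⟩

lemma IsRep.d_comp {e f} (h : IsRep P Y n e f) (m : ℕ) : P.complex.d m n ≫ f = 0 := by
  obtain ⟨z, -, rfl⟩ := h
  exact d_unop_pOpcycles_unop m z

lemma exists_isRep_of_d_comp (f : P.complex.X n ⟶ Y) (m : ℕ) (hm : n + 1 = m)
    (hf : P.complex.d m n ≫ f = 0) : ∃ e, IsRep P Y n e f := by
  obtain ⟨z, hz⟩ := exists_pOpcycles_unop_eq (K := homComplex P Y) f m hm hf
  obtain ⟨e, he⟩ := (extIso_unop_bijective P Y n).2 (((homComplex P Y).homologyι n).unop z)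
  exact ⟨e, z, he, hz⟩

omit n in
lemma extMk_zero_degree_eq_zero_iff (f : P.complex.X 0 ⟶ Y) (m : ℕ) (hm : 0 + 1 = m)
    (hf : P.complex.d m 0 ≫ f = 0) : P.extMk f m hm hf = 0 ↔ f = 0 := by
  refine ⟨fun h => ?_, fun h => by subst h; exact P.extMk_zero m hm⟩
  rw [← P.extEquivCohomologyClass.apply_eq_iff_eq, P.extEquivCohomologyClass_extMk,
    P.extEquivCohomologyClass_zero, CochainComplex.HomComplex.CohomologyClass.mk_eq_zero_iff,
    CochainComplex.HomComplex.Cocycle.toSingleMk_mem_coboundaries_iff _ _ _ _ _ 1 (by simp)] at h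
  obtain ⟨g, hg⟩ := h
  have hz : Limits.IsZero (P.cochainComplex.X 1) :=
    CochainComplex.isZero_of_isStrictlyLE _ 0 1 (by norm_num)
  rw [hz.eq_of_src g 0, Limits.comp_zero] at hg
  rw [← cancel_epi (P.cochainComplexXIso (-((0 : ℕ) : ℤ)) 0 rfl).hom, Limits.comp_zero]
  exact hg.symm

lemma IsRep.eq_zero_iff {e f} (h : IsRep P Y n e f) (m : ℕ) (hm : n + 1 = m) :
    e = 0 ↔ P.extMk f m hm (h.d_comp m) = 0 := by
  have hd := h.d_comp m
  obtain ⟨z, h1, h2⟩ := h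
  have key : e = 0 ↔ ((homComplex P Y).homologyι n).unop z = 0 := by
    rw [← map_eq_zero_iff _ (extIso_unop_bijective P Y n).1, h1]
  refine key.trans ?_
  cases n with
  | zero =>
    rw [extMk_zero_degree_eq_zero_iff f m hm hd,
      map_eq_zero_iff _ homologyι_zero_unop_injective, ← h2]
    exact (map_eq_zero_iff ((homComplex P Y).pOpcycles 0).unop.hom pOpcycles_unop_injective).symm
  | succ p =>
    rw [P.extMk_eq_zero_iff f m hm hd p rfl, homologyι_unop_eq_zero_iff z p rfl, h2]
    rfl

lemma IsRep.map {e f} (h : IsRep P Y n e f) {X' : ModuleCat.{u} R} {P' : ProjectiveResolution X'}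
    {g : X' ⟶ X} (φ : ProjectiveResolution.Hom P' P g) :
    IsRep P' Y n (((_root_.Ext R (ModuleCat.{u} R) n).map g.op).app Y e) (φ.hom.f n ≫ f) := by
  have hd : P'.complex.d (n + 1) n ≫ φ.hom.f n ≫ f = 0 := by
    simp [← φ.hom.comm_assoc, h.d_comp]
  obtain ⟨z', hz'⟩ := exists_pOpcycles_unop_eq (K := homComplex P' Y) (φ.hom.f n ≫ f) _ rfl hd
  obtain ⟨z, h1, h2⟩ := h
  refine ⟨z', ?_, hz'⟩
  rw [extIso_naturality P Y n g φ, h1]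
  exact homologyMap_unop_homologyι_unop _ z z' (by rw [hz', h2]; rfl)

lemma smul_extMk (f : P.complex.X n ⟶ Y) (m : ℕ) (hm : n + 1 = m)
    (hf : P.complex.d m n ≫ f = 0) (r : R) :
    r • P.extMk f m hm hf = P.extMk (r • f) m hm (by simp [hf]) := by
  rw [Abelian.Ext.smul_eq_comp_mk₀, P.extMk_comp_mk₀]
  simp

end ExtComparison

section LocalCohomology
open Limits Opposite ExtComparison

variable {R : Type} [CommRing R] (J : Ideal R) (i : ℕ) (M : ModuleCat.{0} R)

/-- The directed system computing local cohomology. -/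
abbrev extDiagram : (ℕᵒᵖ)ᵒᵖ ⥤ ModuleCat.{0} R :=
  localCohomology.diagram (localCohomology.idealPowersDiagram J) i ⋙ (evaluation _ _).obj M

/-- Local cohomology is the direct limit of the `Ext^i(R/J^t, M)`. -/
def localCohomologyIso : (localCohomology J i).obj M ≅ colimit (extDiagram J i M) :=
  colimitObjIsoColimitCompEvaluation _ _

/-- The module `R/J^t`. -/
abbrev quotPow (t : ℕ) : ModuleCat.{0} R := ModuleCat.of R (R ⧸ J ^ t)

/-- The projection `R/J^s → R/J^t` for `t ≤ s`. -/
def quotPowMap {s t : ℕ} (h : t ≤ s) : quotPow J s ⟶ quotPow J t :=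
  ModuleCat.ofHom (Submodule.mapQ _ _ LinearMap.id (Ideal.pow_le_pow_right h))

variable {J i M}

lemma smul_eq_zero_of_forall_extDiagram {x : R}
    (h : ∀ (t : ℕ) (e : (extDiagram J i M).obj (op (op t))), x • e = 0)
    (y : (localCohomology J i).obj M) : x • y = 0 := by
  obtain ⟨j, e, he⟩ := Concrete.colimit_exists_rep (extDiagram J i M)
    ((localCohomologyIso J i M).hom y)
  apply (ConcreteCategory.bijective_of_isIso (localCohomologyIso J i M).hom).1
  rw [map_smul, map_zero, ← he, ← map_smul, h j.unop.unop e, map_zero]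

lemma exists_extDiagram_map_smul_eq_zero {x : R}
    (h : ∀ y : (localCohomology J i).obj M, x • y = 0) (t : ℕ)
    (e : (extDiagram J i M).obj (op (op t))) :
    ∃ (s : ℕ) (hs : t ≤ s), x • ((extDiagram J i M).map (homOfLE hs).op.op e) = 0 := by
  have h1 : colimit.ι (extDiagram J i M) (op (op t)) (x • e) =
      colimit.ι (extDiagram J i M) (op (op t)) 0 := by
    obtain ⟨y, hy⟩ := (ConcreteCategory.bijective_of_isIso (localCohomologyIso J i M).hom).2
      (colimit.ι (extDiagram J i M) (op (op t)) e)
    rw [map_smul, ← hy, ← map_smul, h, map_zero, map_zero]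
  obtain ⟨k, f, g, hfg⟩ := Concrete.colimit_exists_of_rep_eq (extDiagram J i M) _ _ h1
  refine ⟨k.unop.unop, leOfHom f.unop.unop, ?_⟩
  rw [map_zero, map_smul] at hfg
  exact hfg

lemma smul_localCohomology_eq_zero {x : R}
    (h : ∀ (t : ℕ) (e : Abelian.Ext (quotPow J t) M i), x • e = 0)
    (y : (localCohomology J i).obj M) : x • y = 0 := by
  refine smul_eq_zero_of_forall_extDiagram (fun t e => ?_) y
  let P := ProjectiveResolution.of (quotPow J t)
  obtain ⟨f, hf⟩ := exists_isRep (P := P) (Y := M) (n := i) e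
  refine ((hf.smul x).eq_zero_iff _ rfl).2 ?_
  rw [← smul_extMk _ _ _ (hf.d_comp _)]
  exact h t _

lemma exists_smul_comp_eq_zero {x : R}
    (h : ∀ y : (localCohomology J i).obj M, x • y = 0) (t : ℕ)
    (e : Abelian.Ext (quotPow J t) M i) :
    ∃ (s : ℕ) (hs : t ≤ s),
      x • (Abelian.Ext.mk₀ (quotPowMap J hs)).comp e (zero_add i) = 0 := by
  let P := ProjectiveResolution.of (quotPow J t)
  obtain ⟨f, hd, rfl⟩ := P.extMk_surjective e _ rfl
  obtain ⟨e', he'⟩ := exists_isRep_of_d_comp f _ rfl hd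
  obtain ⟨s, hs, h0⟩ := exists_extDiagram_map_smul_eq_zero h t e'
  refine ⟨s, hs, ?_⟩
  let P' := ProjectiveResolution.of (quotPow J s)
  let φ : ProjectiveResolution.Hom P' P (quotPowMap J hs) :=
    ⟨ProjectiveResolution.lift (quotPowMap J hs) P' P, by
      exact HomologicalComplex.congr_hom
        (ProjectiveResolution.lift_commutes (quotPowMap J hs) P' P) 0⟩
  have h1 := (he'.map φ).smul x
  rw [ProjectiveResolution.mk₀_comp_extMk _ _ _ _ φ, smul_extMk]
  exact (h1.eq_zero_iff _ rfl).1 h0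

end LocalCohomology

section ExtAnnihilators
open Abelian

variable {R : Type} [CommRing R]

section General
variable {X N : ModuleCat.{0} R} {j : ℕ} {x : R}

lemma smul_ext_eq_zero_of_target (h : ∀ n : N, x • n = 0) (e : Ext X N j) : x • e = 0 := by
  have h0 : x • 𝟙 N = 0 := by
    ext n
    exact h n
  rw [Ext.smul_eq_comp_mk₀, h0, Ext.mk₀_zero, Ext.comp_zero]

lemma smul_ext_eq_mk₀_comp (e : Ext X N j) :
    x • e = (Ext.mk₀ (x • 𝟙 X)).comp e (zero_add j) := by
  rw [Ext.mk₀_smul, Ext.smul_comp, Ext.mk₀_id_comp]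

lemma smul_ext_eq_zero_of_source (h : ∀ n : X, x • n = 0) (e : Ext X N j) : x • e = 0 := by
  have h0 : x • 𝟙 X = 0 := by
    ext n
    exact h n
  rw [smul_ext_eq_mk₀_comp, h0, Ext.mk₀_zero, Ext.zero_comp]

lemma smul_ext_zero_eq_zero_iff (f : X ⟶ N) : x • Ext.mk₀ f = 0 ↔ ∀ y, x • f y = 0 := by
  rw [← Ext.mk₀_smul, Ext.mk₀_eq_zero_iff, ModuleCat.hom_ext_iff, LinearMap.ext_iff]
  rfl

end General

/-- Some element outside `p` kills all `Ext^j(X, N)` with `X` in the class `𝓛`. -/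
def UniformlyKilled (p : Ideal R) (𝓛 : ModuleCat.{0} R → Prop) (j : ℕ) (N : ModuleCat.{0} R) :
    Prop :=
  ∃ x ∉ p, ∀ X, 𝓛 X → ∀ e : Ext X N j, x • e = 0

/-- Some element outside `p` kills the direct limit of the `Ext^j(R/J^t, N)`. -/
def KilledInLimit (J p : Ideal R) (j : ℕ) (N : ModuleCat.{0} R) : Prop :=
  ∃ x ∉ p, ∀ (t : ℕ) (e : Ext (quotPow J t) N j), ∃ (s : ℕ) (hs : t ≤ s),
    x • (Ext.mk₀ (quotPowMap J hs)).comp e (zero_add j) = 0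

variable {p J : Ideal R} {𝓛 : ModuleCat.{0} R → Prop} {j : ℕ} {S : ShortComplex (ModuleCat.{0} R)}

lemma UniformlyKilled.of_smul {N : ModuleCat.{0} R} {x : R} (hx : x ∉ p)
    (h : ∀ n : N, x • n = 0) : UniformlyKilled p 𝓛 j N :=
  ⟨x, hx, fun _ _ e => smul_ext_eq_zero_of_target h e⟩

lemma KilledInLimit.of_forall {N : ModuleCat.{0} R} {x : R} (hx : x ∉ p)
    (h : ∀ (t : ℕ) (e : Ext (quotPow J t) N j), x • e = 0) : KilledInLimit J p j N :=
  ⟨x, hx, fun t e => ⟨t, le_rfl, by rw [← Ext.comp_smul, h, Ext.comp_zero]⟩⟩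

lemma UniformlyKilled.mono {𝓛' : ModuleCat.{0} R → Prop} {N : ModuleCat.{0} R}
    (h : UniformlyKilled p 𝓛 j N) (h' : ∀ X, 𝓛' X → 𝓛 X) : UniformlyKilled p 𝓛' j N := by
  obtain ⟨x, hx, H⟩ := h
  exact ⟨x, hx, fun X hX => H X (h' X hX)⟩

variable [hp : p.IsPrime]
include hp

lemma UniformlyKilled.middle (hS : S.ShortExact) (h1 : UniformlyKilled p 𝓛 j S.X₁)
    (h3 : UniformlyKilled p 𝓛 j S.X₃) : UniformlyKilled p 𝓛 j S.X₂ := by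
  obtain ⟨x, hx, Hx⟩ := h1
  obtain ⟨y, hy, Hy⟩ := h3
  refine ⟨x * y, hp.mul_notMem hx hy, fun X hX e => ?_⟩
  obtain ⟨e', he'⟩ := Ext.covariant_sequence_exact₂ X hS (y • e)
    (by rw [Ext.smul_comp, Hy X hX])
  rw [mul_smul, ← he', ← Ext.smul_comp, Hx X hX, Ext.zero_comp]

lemma UniformlyKilled.right (hS : S.ShortExact) (h2 : UniformlyKilled p 𝓛 j S.X₂)
    (h1 : UniformlyKilled p 𝓛 (j + 1) S.X₁) : UniformlyKilled p 𝓛 j S.X₃ := by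
  obtain ⟨x, hx, Hx⟩ := h2
  obtain ⟨y, hy, Hy⟩ := h1
  refine ⟨x * y, hp.mul_notMem hx hy, fun X hX e => ?_⟩
  obtain ⟨e', he'⟩ := Ext.covariant_sequence_exact₃ X hS (y • e) rfl
    (by rw [Ext.smul_comp, Hy X hX])
  rw [mul_smul, ← he', ← Ext.smul_comp, Hx X hX, Ext.zero_comp]

lemma UniformlyKilled.left (hS : S.ShortExact) (h2 : UniformlyKilled p 𝓛 (j + 1) S.X₂)
    (h3 : UniformlyKilled p 𝓛 j S.X₃) : UniformlyKilled p 𝓛 (j + 1) S.X₁ := by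
  obtain ⟨x, hx, Hx⟩ := h3
  obtain ⟨y, hy, Hy⟩ := h2
  refine ⟨x * y, hp.mul_notMem hx hy, fun X hX e => ?_⟩
  obtain ⟨e', he'⟩ := Ext.covariant_sequence_exact₁ X hS (y • e)
    (by rw [Ext.smul_comp, Hy X hX]) rfl
  rw [mul_smul, ← he', ← Ext.smul_comp, Hx X hX, Ext.zero_comp]

omit hp in
lemma UniformlyKilled.left_zero (hS : S.ShortExact) (h2 : UniformlyKilled p 𝓛 0 S.X₂) :
    UniformlyKilled p 𝓛 0 S.X₁ := by
  obtain ⟨x, hx, Hx⟩ := h2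
  refine ⟨x, hx, fun X hX e => ?_⟩
  have := hS.mono_f
  apply Ext.postcomp_mk₀_injective_of_mono X S.f
  change (x • e).comp (Ext.mk₀ S.f) (add_zero 0) =
    (0 : Ext X S.X₁ 0).comp (Ext.mk₀ S.f) (add_zero 0)
  rw [Ext.smul_comp, Hx X hX, Ext.zero_comp]

omit hp in
lemma quotPowMap_comp {a b c : ℕ} (h : a ≤ b) (h' : b ≤ c) :
    quotPowMap J h' ≫ quotPowMap J h = quotPowMap J (h.trans h') := by
  ext
  rfl

lemma KilledInLimit.right (hS : S.ShortExact) (h2 : KilledInLimit J p j S.X₂)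
    (h1 : KilledInLimit J p (j + 1) S.X₁) : KilledInLimit J p j S.X₃ := by
  obtain ⟨x, hx, Hx⟩ := h2
  obtain ⟨y, hy, Hy⟩ := h1
  refine ⟨x * y, hp.mul_notMem hx hy, fun t e => ?_⟩
  obtain ⟨s, hs, h0⟩ := Hy t (e.comp hS.extClass rfl)
  obtain ⟨e', he'⟩ := Ext.covariant_sequence_exact₃ _ hS
    (y • (Ext.mk₀ (quotPowMap J hs)).comp e (zero_add j)) rfl (by
      rw [Ext.smul_comp, Ext.comp_assoc _ _ _ (zero_add j) rfl (by lia), h0])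
  obtain ⟨r, hr, h0'⟩ := Hx s e'
  refine ⟨r, hs.trans hr, ?_⟩
  rw [← quotPowMap_comp hs hr, ← Ext.mk₀_comp_mk₀_assoc, mul_smul, ← Ext.comp_smul, ← he',
    ← Ext.comp_assoc _ _ _ (zero_add j) (add_zero j) (by lia), ← Ext.smul_comp, h0',
    Ext.zero_comp]

end ExtAnnihilators

section Torsion
open Abelian

variable {R : Type} [CommRing R]

lemma shortExact_of_exact {A B C : Type} [AddCommGroup A] [AddCommGroup B] [AddCommGroup C]
    [Module R A] [Module R B] [Module R C] (f : A →ₗ[R] B) (g : B →ₗ[R] C)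
    (hf : Function.Injective f) (hfg : Function.Exact f g) (hg : Function.Surjective g) :
    (ModuleCat.shortComplexOfCompEqZero f g hfg.linearMap_comp_eq_zero).ShortExact :=
  ModuleCat.shortComplex_shortExact _ hfg hf hg

/-- The modules killed by a power of `J`. -/
def IsKilledByPow (J : Ideal R) (L : ModuleCat.{0} R) : Prop :=
  ∃ k : ℕ, ∀ a ∈ J ^ k, ∀ l : L, a • l = 0

lemma isKilledByPow_quotPow (J : Ideal R) (t : ℕ) : IsKilledByPow J (quotPow J t) := by
  refine ⟨t, fun a ha l => ?_⟩
  obtain ⟨b, rfl⟩ := Ideal.Quotient.mk_surjective l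
  change Ideal.Quotient.mk (J ^ t) (a * b) = 0
  exact Ideal.Quotient.eq_zero_iff_mem.2 (Ideal.mul_mem_right _ _ ha)

variable (S : Finset R) (N : Type) [AddCommGroup N] [Module R N]

/-- The product of the localizations of `N` away from the elements of `S`. -/
abbrev ProdAway : Type := (y : S) → LocalizedModule (Submonoid.powers y.1) N

/-- The canonical map from `N` to the product of its localizations. -/
def toProdAway : N →ₗ[R] ProdAway S N :=
  LinearMap.pi fun _ => LocalizedModule.mkLinearMap _ N

variable {S N} {J : Ideal R}

lemma ext_away_eq_zero {y : R} (hy : y ∈ J) {L : ModuleCat.{0} R} (hL : IsKilledByPow J L) {j : ℕ}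
    (e : Ext L (ModuleCat.of R (LocalizedModule (Submonoid.powers y) N)) j) : e = 0 := by
  obtain ⟨k, hk⟩ := hL
  have hu := IsLocalizedModule.map_units (S := Submonoid.powers y)
    (LocalizedModule.mkLinearMap (Submonoid.powers y) N) ⟨y ^ k, k, rfl⟩
  obtain ⟨g, hg⟩ := hu.exists_right_inv
  have h1 : 𝟙 (ModuleCat.of R (LocalizedModule (Submonoid.powers y) N)) =
      y ^ k • ModuleCat.ofHom g := by
    apply ModuleCat.hom_ext
    exact hg.symm
  rw [← Ext.comp_mk₀_id e, h1, Ext.mk₀_smul, Ext.comp_smul]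
  exact smul_ext_eq_zero_of_source (hk _ (Ideal.pow_mem_pow hy k)) _

lemma ext_prodAway_eq_zero (hS : ∀ y ∈ S, y ∈ J) {L : ModuleCat.{0} R} (hL : IsKilledByPow J L)
    {j : ℕ} (e : Ext L (ModuleCat.of R (ProdAway S N)) j) : e = 0 := by
  classical
  have h1 : 𝟙 (ModuleCat.of R (ProdAway S N)) = ∑ y : S,
      ModuleCat.ofHom (LinearMap.proj y : ProdAway S N →ₗ[R] _) ≫
        ModuleCat.ofHom
          (LinearMap.single R (fun y : S => LocalizedModule (Submonoid.powers y.1) N) y) := by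
    apply ModuleCat.hom_ext
    rw [ModuleCat.hom_sum]
    refine LinearMap.ext fun v => ?_
    rw [LinearMap.sum_apply]
    exact (Finset.univ_sum_single v).symm
  rw [← Ext.comp_mk₀_id e, h1, Ext.mk₀_sum, Ext.comp_sum]
  refine Finset.sum_eq_zero fun y _ => ?_
  rw [← Ext.mk₀_comp_mk₀, ← Ext.comp_assoc _ _ _ (add_zero j) (add_zero 0) (by lia),
    ext_away_eq_zero (hS y y.2) hL (e.comp _ _), Ext.zero_comp]

lemma exists_pow_le_of_mem_ker_toProdAway {n : N} (hn : n ∈ LinearMap.ker (toProdAway S N)) :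
    ∃ t, ∀ a ∈ Ideal.span (S : Set R) ^ t, a • n = 0 := by
  have h1 : Ideal.span (S : Set R) ≤
      Ideal.radical (LinearMap.ker (LinearMap.toSpanSingleton R N n)) := by
    rw [Ideal.span_le]
    intro y hy
    have h2 : LocalizedModule.mkLinearMap (Submonoid.powers y) N n = 0 := congrFun hn ⟨y, hy⟩
    obtain ⟨⟨c, k, rfl⟩, hc⟩ := (IsLocalizedModule.eq_zero_iff (Submonoid.powers y) _).1 h2
    exact ⟨k, hc⟩
  obtain ⟨t, ht⟩ := Ideal.exists_pow_le_of_le_radical_of_fg h1 ⟨S, rfl⟩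
  exact ⟨t, fun a ha => ht ha⟩

lemma smul_eq_zero_of_limit {x : R} {N : ModuleCat.{0} R}
    (h : ∀ (t : ℕ) (e : Ext (quotPow J t) N 0), ∃ (s : ℕ) (hs : t ≤ s),
      x • (Ext.mk₀ (quotPowMap J hs)).comp e (zero_add 0) = 0)
    {n : N} {t : ℕ} (hn : ∀ a ∈ J ^ t, a • n = 0) : x • n = 0 := by
  let φ : quotPow J t ⟶ N := ModuleCat.ofHom
    (Submodule.liftQ (J ^ t) (LinearMap.toSpanSingleton R N n) hn)
  obtain ⟨s, hs, h0⟩ := h t (Ext.mk₀ φ)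
  rw [Ext.mk₀_comp_mk₀, smul_ext_zero_eq_zero_iff] at h0
  have h1 := h0 (Ideal.Quotient.mk _ 1)
  have h2 : (quotPowMap J hs ≫ φ) (Ideal.Quotient.mk _ 1) = n := one_smul R n
  rwa [h2] at h1

theorem uniformlyKilled_of_killedInLimit (hJ : J.FG) {p : Ideal R} [hp : p.IsPrime] (i : ℕ) :
    ∀ N : ModuleCat.{0} R, (∀ j ≤ i, KilledInLimit J p j N) →
      UniformlyKilled p (IsKilledByPow J) i N := by
  obtain ⟨S, hS⟩ := hJ
  have hSJ : ∀ y ∈ S, y ∈ J := fun y hy => hS ▸ Ideal.subset_span hy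
  induction i with
  | zero =>
    intro N hN
    obtain ⟨x, hx, H⟩ := hN 0 le_rfl
    refine ⟨x, hx, fun L ⟨k, hk⟩ e => ?_⟩
    obtain ⟨g, rfl⟩ := Ext.addEquiv₀.symm.surjective e
    refine (smul_ext_zero_eq_zero_iff g).2 fun y => ?_
    refine smul_eq_zero_of_limit H (t := k) fun a ha => ?_
    rw [← map_smul, hk a ha, map_zero]
  | succ i ih =>
    intro N hN
    obtain ⟨x, hx, H⟩ := hN 0 (Nat.zero_le _)
    let f := toProdAway S N
    have hK : ∀ n : LinearMap.ker f, x • n = 0 := fun n => by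
      obtain ⟨t, ht⟩ := exists_pow_le_of_mem_ker_toProdAway n.2
      change Ideal.span (S : Set R) = J at hS
      rw [hS] at ht
      exact Subtype.ext (smul_eq_zero_of_limit H ht)
    have h1 := shortExact_of_exact (LinearMap.ker f).subtype f.rangeRestrict
      (Submodule.injective_subtype _) (by rw [LinearMap.exact_iff]; simp)
      f.surjective_rangeRestrict
    have h2 := shortExact_of_exact (LinearMap.range f).subtype (LinearMap.range f).mkQ
      (Submodule.injective_subtype _) (by rw [LinearMap.exact_iff]; simp)
      (Submodule.mkQ_surjective _)
    have hQ (j : ℕ) : KilledInLimit J p j (ModuleCat.of R (ProdAway S N)) :=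
      .of_forall hp.one_notMem fun t e => by
        rw [ext_prodAway_eq_zero hSJ (isKilledByPow_quotPow J t) e, smul_zero]
    have hKj (j : ℕ) : KilledInLimit J p j (ModuleCat.of R (LinearMap.ker f)) :=
      .of_forall hx fun t e => smul_ext_eq_zero_of_target hK e
    refine UniformlyKilled.middle h1 (.of_smul hx hK) (UniformlyKilled.left h2 ?_ (ih _ ?_))
    · refine ⟨1, hp.one_notMem, fun L hL e => ?_⟩
      rw [ext_prodAway_eq_zero hSJ hL e, smul_zero]
    · intro j hj
      exact KilledInLimit.right h2 (hQ j)
        (KilledInLimit.right h1 (hN (j + 1) (by lia)) (hKj (j + 2)))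

end Torsion

section FiniteModules
open Abelian IsLocalRing

variable {R : Type} [CommRing R] [IsNoetherianRing R] [IsLocalRing R]

/-- Finitely generated modules with support of dimension less than `e`. -/
def IsFiniteOfDimLT (e : ℕ) (L : ModuleCat.{0} R) : Prop :=
  Module.Finite R L ∧ Module.supportDim R L < e

omit [IsLocalRing R] in
lemma exists_torsion_submodule (J : Ideal R) (L : Type) [AddCommGroup L] [Module R L]
    [Module.Finite R L] : ∃ T : Submodule R L, (∃ k, ∀ a ∈ J ^ k, ∀ l ∈ T, a • l = 0) ∧
      ∀ l, (∀ a ∈ J, a • l ∈ T) → l ∈ T := by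
  obtain ⟨n, hn⟩ := monotone_stabilizes_iff_noetherian.2 (inferInstance : IsNoetherian R L)
    ⟨fun k => Submodule.torsionBySet R L (J ^ k : Ideal R),
      fun i j h => Submodule.torsionBySet_le_torsionBySet_pow i j h J⟩
  refine ⟨_, ⟨n, fun a ha l hl => (Submodule.mem_torsionBySet_iff _ _).1 hl ⟨a, ha⟩⟩,
    fun l hl => ?_⟩
  change l ∈ Submodule.torsionBySet R L (J ^ n : Ideal R)
  have h1 := hn (n + 1) (Nat.le_succ n)
  change Submodule.torsionBySet R L (J ^ n : Ideal R) =
    Submodule.torsionBySet R L (J ^ (n + 1) : Ideal R) at h1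
  rw [h1, pow_succ, Submodule.mem_torsionBySet_iff]
  rintro ⟨a, ha⟩
  change a • l = 0
  induction ha using Submodule.mul_induction_on' with
  | mem_mul_mem b hb c hc =>
    rw [mul_smul]
    exact (Submodule.mem_torsionBySet_iff _ _).1 (hl c hc) ⟨b, hb⟩
  | add b _ c _ h h' => rw [add_smul, h, h', add_zero]

lemma exists_regular {L : Type} [AddCommGroup L] [Module R L] [Module.Finite R L]
    (h : ∀ l : L, (∀ a ∈ maximalIdeal R, a • l = 0) → l = 0) :
    ∃ y ∈ maximalIdeal R, IsSMulRegular L y := by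
  have : Subsingleton ((R ⧸ maximalIdeal R) →ₗ[R] L) := by
    refine subsingleton_of_forall_eq 0 fun f => ?_
    refine LinearMap.ext fun z => h _ fun a ha => ?_
    obtain ⟨b, rfl⟩ := Ideal.Quotient.mk_surjective z
    rw [← map_smul]
    convert map_zero f
    change Ideal.Quotient.mk (maximalIdeal R) (a * b) = 0
    exact Ideal.Quotient.eq_zero_iff_mem.2 (Ideal.mul_mem_right _ _ ha)
  obtain ⟨y, hy, hr⟩ := IsSMulRegular.subsingleton_linearMap_iff.1 this
  exact ⟨y, by rwa [Ideal.annihilator_quotient] at hy, hr⟩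

lemma supportDim_quotSMulTop_lt {L : Type} [AddCommGroup L] [Module R L] [Module.Finite R L]
    {e : ℕ} (h : Module.supportDim R L < (e + 1 : ℕ)) {y : R} (hy : y ∈ maximalIdeal R)
    (hr : IsSMulRegular L y) : Module.supportDim R (QuotSMulTop y L) < e := by
  rw [← Module.supportDim_quotSMulTop_succ_eq_supportDim hr hy, Nat.cast_add, Nat.cast_one] at h
  exact lt_of_add_lt_add_right h

lemma ext_eq_zero_of_forall_mem_pow_smul {L M : ModuleCat.{0} R} [Module.Finite R L]
    [Module.Finite R M] {i : ℕ} {y : R} (hy : y ∈ maximalIdeal R) (e : Ext L M i)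
    (h : ∀ t : ℕ, 0 < t → ∃ e' : Ext L M i, y ^ t • e' = e) : e = 0 := by
  have h1 : e ∈ (⨅ t : ℕ, maximalIdeal R ^ t • ⊤ : Submodule R (Ext L M i)) := by
    refine (Submodule.mem_iInf _).2 fun t => ?_
    obtain ⟨e', rfl⟩ := h (t + 1) (Nat.succ_pos t)
    exact Submodule.smul_mem_smul (Ideal.pow_le_pow_right (Nat.le_succ t)
      (Ideal.pow_mem_pow hy _)) trivial
  rwa [Ideal.iInf_pow_smul_eq_bot_of_isLocalRing _ (Ideal.IsPrime.ne_top'), Submodule.mem_bot] at h1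

theorem uniformlyKilled_of_finite {p : Ideal R} [hp : p.IsPrime] {M : ModuleCat.{0} R}
    [Module.Finite R M] {d : ℕ}
    (hM : ∀ i < d, UniformlyKilled p (IsKilledByPow (maximalIdeal R)) i M) (e : ℕ) :
    ∀ i, i + e ≤ d → UniformlyKilled p (IsFiniteOfDimLT e) i M := by
  induction e with
  | zero =>
    intro i _
    refine ⟨1, hp.one_notMem, fun L hL e => smul_ext_eq_zero_of_source (fun l => ?_) e⟩
    have : Subsingleton L := by
      by_contra h
      have := not_subsingleton_iff_nontrivial.1 h
      have := (Module.nonempty_support_of_nontrivial (R := R) (M := L)).to_subtype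
      exact (Order.krullDim_nonneg.trans_lt hL.2).false
    exact Subsingleton.elim _ _
  | succ d' ih =>
    intro i hi
    obtain ⟨x₁, hx₁, H₁⟩ := ih (i + 1) (by lia)
    obtain ⟨x₂, hx₂, H₂⟩ := hM i (by lia)
    refine ⟨x₁ * x₂, hp.mul_notMem hx₁ hx₂, fun L ⟨hL, hdim⟩ e => ?_⟩
    obtain ⟨T, ⟨k, hk⟩, hT⟩ := exists_torsion_submodule (maximalIdeal R) L
    obtain ⟨y, hy, hreg⟩ := exists_regular (L := L ⧸ T) (by
      intro l hl
      obtain ⟨l, rfl⟩ := T.mkQ_surjective l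
      refine (Submodule.Quotient.mk_eq_zero T).2 (hT l fun a ha => ?_)
      exact (Submodule.Quotient.mk_eq_zero T).1 (hl a ha))
    have hdim' : Module.supportDim R (L ⧸ T) < (d' + 1 : ℕ) :=
      (Module.supportDim_le_of_surjective _ T.mkQ_surjective).trans_lt hdim
    have key (e' : Ext (ModuleCat.of R (L ⧸ T)) M i) : x₁ • e' = 0 := by
      refine ext_eq_zero_of_forall_mem_pow_smul hy _ fun t ht => ?_
      have hS := (hreg.pow t).smulShortComplex_shortExact (M := ModuleCat.of R (L ⧸ T))
      have h1 := supportDim_quotSMulTop_lt hdim' (Ideal.pow_mem_of_mem _ hy t ht) (hreg.pow t)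
      obtain ⟨e'', he''⟩ := Ext.contravariant_sequence_exact₁ hS M (x₁ • e') (add_comm 1 i)
        ((Ext.comp_smul hS.extClass _ _ x₁).trans (H₁ _
          ⟨inferInstanceAs (Module.Finite R (QuotSMulTop (y ^ t) (L ⧸ T))), h1⟩ _))
      exact ⟨e'', (smul_ext_eq_mk₀_comp _).trans he''⟩
    have hS := shortExact_of_exact T.subtype T.mkQ T.injective_subtype
      (by rw [LinearMap.exact_iff]; simp) T.mkQ_surjective
    obtain ⟨e', he'⟩ := Ext.contravariant_sequence_exact₂ hS M (x₂ • e)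
      (by rw [Ext.comp_smul]; exact H₂ _ ⟨k, fun a ha (l : T) => Subtype.ext (hk a ha l.1 l.2)⟩ _)
    rw [mul_smul, ← he', ← Ext.comp_smul, key, Ext.comp_zero]

end FiniteModules

section SupportReduction
open Abelian Pointwise

variable {R : Type} [CommRing R] {p : Ideal R} [hp : p.IsPrime] {𝓛 : ModuleCat.{0} R → Prop}
variable {M : Type} [AddCommGroup M] [Module R M]

lemma UniformlyKilled.quotSMulTop {j : ℕ} (x : R)
    (hK : ∃ y ∉ p, ∀ m : M, x • m = 0 → y • m = 0)
    (h0 : UniformlyKilled p 𝓛 j (ModuleCat.of R M))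
    (h1 : UniformlyKilled p 𝓛 (j + 1) (ModuleCat.of R M)) :
    UniformlyKilled p 𝓛 j (ModuleCat.of R (QuotSMulTop x M)) := by
  let f := LinearMap.lsmul R M x
  have hS := shortExact_of_exact (LinearMap.ker f).subtype f.rangeRestrict
    (Submodule.injective_subtype _) (by rw [LinearMap.exact_iff]; simp) f.surjective_rangeRestrict
  have hS' := shortExact_of_exact (LinearMap.range f).subtype (x • ⊤ : Submodule R M).mkQ
    (Submodule.injective_subtype _) (by
      rw [LinearMap.exact_iff, (LinearMap.exact_lsmul_mkQ_smul_top M x).linearMap_ker_eq,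
        Submodule.range_subtype]) (Submodule.mkQ_surjective _)
  obtain ⟨y, hy, H⟩ := hK
  refine UniformlyKilled.right hS' h0 (UniformlyKilled.right hS h1 (.of_smul hy ?_))
  exact fun (n : LinearMap.ker f) => Subtype.ext (H n.1 n.2)

variable [IsNoetherianRing R] [Module.Finite R M]

lemma exists_le_mem_associatedPrimes_of_mem_support {P : PrimeSpectrum R}
    (h : P ∈ Module.support R M) : ∃ q ∈ associatedPrimes R M, q ≤ P.asIdeal := by
  obtain ⟨q, hq, hle⟩ := Ideal.exists_minimalPrimes_le (Module.mem_support_iff_of_finite.1 h)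
  exact ⟨q, Module.associatedPrimes.minimalPrimes_annihilator_subset_associatedPrimes R M hq, hle⟩

omit hp in
lemma exists_mem_forall_notMem_associatedPrimes (h : p ∉ associatedPrimes R M) :
    ∃ x ∈ p, ∀ q ∈ associatedPrimes R M, q ≤ p → x ∉ q := by
  by_contra! H
  have h1 : (p : Set R) ⊆ ⋃ q ∈ {q ∈ associatedPrimes R M | q ≤ p}, (q : Set R) := by
    intro x hx
    obtain ⟨q, hq, hle, hxq⟩ := H x hx
    exact Set.mem_biUnion (x := q) ⟨hq, hle⟩ hxq
  obtain ⟨q, ⟨hq, hle⟩, hle'⟩ := (Ideal.subset_union_prime_finite (f := id)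
    ((associatedPrimes.finite R M).subset (Set.sep_subset _ _)) ⊥ ⊥
    fun q hq _ _ => hq.1.isPrime).1 h1
  exact h (le_antisymm hle hle' ▸ hq)

lemma exists_notMem_smul_eq_zero {x : R}
    (h : ∀ q ∈ associatedPrimes R M, q ≤ p → x ∉ q) :
    ∃ y ∉ p, ∀ m : M, x • m = 0 → y • m = 0 := by
  by_contra! H
  let K := LinearMap.ker (LinearMap.lsmul R M x)
  have h1 : (⟨p, hp⟩ : PrimeSpectrum R) ∈ Module.support R K := by
    refine Module.mem_support_iff_of_finite.2 fun y hy => ?_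
    by_contra hy'
    obtain ⟨m, hm, hm'⟩ := H y hy'
    exact hm' (congrArg Subtype.val (Module.mem_annihilator.1 hy (⟨m, hm⟩ : K)))
  obtain ⟨q, hq, hle⟩ := exists_le_mem_associatedPrimes_of_mem_support h1
  refine h q (associatedPrimes.subset_of_injective K.injective_subtype hq) hle ?_
  refine hq.annihilator_le ?_
  exact Submodule.mem_annihilator.2 fun k _ => Subtype.ext k.2

omit hp [Module.Finite R M] in
lemma notMem_associatedPrimes_of_uniformlyKilled
    (h : UniformlyKilled p (· = ModuleCat.of R (R ⧸ p)) 0 (ModuleCat.of R M)) :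
    p ∉ associatedPrimes R M := by
  intro ha
  obtain ⟨-, f, hf⟩ := (isAssociatedPrime_iff_exists_injective_linearMap p M).1 ha
  obtain ⟨x, hx, H⟩ := h
  have h1 := (smul_ext_zero_eq_zero_iff (x := x) (ModuleCat.ofHom f)).1 (H _ rfl _)
    (Ideal.Quotient.mk p 1)
  rw [← map_smul] at h1
  have h2 := hf (h1.trans (map_zero f).symm)
  have h3 : Ideal.Quotient.mk p (x * 1) = 0 := h2
  rw [mul_one] at h3
  exact hx (Ideal.Quotient.eq_zero_iff_mem.1 h3)

theorem exists_uniformlyKilled_of_isolated (P : PrimeSpectrum R)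
    {e : ℕ} {𝓛 : ModuleCat.{0} R → Prop} (c : ℕ) :
    ∀ (M : Type) [AddCommGroup M] [Module R M] [Module.Finite R M], P ∈ Module.support R M →
      (∀ i < c, UniformlyKilled P.asIdeal (· = ModuleCat.of R (R ⧸ P.asIdeal)) i
        (ModuleCat.of R M)) →
      (∀ l : LTSeries (PrimeSpectrum R), l.head ∈ Module.support R M → l.last = P →
        l.length ≤ c) →
      (∀ j < e + c, UniformlyKilled P.asIdeal 𝓛 j (ModuleCat.of R M)) →
      ∃ (B : Type) (_ : AddCommGroup B) (_ : Module R B) (_ : Module.Finite R B),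
        P ∈ Module.support R B ∧ (∀ q ∈ Module.support R B, q ≤ P → q = P) ∧
          ∀ j < e, UniformlyKilled P.asIdeal 𝓛 j (ModuleCat.of R B) := by
  induction c with
  | zero =>
    intro M _ _ _ hP _ hl hM
    refine ⟨M, inferInstance, inferInstance, inferInstance, hP, fun q hq hle => ?_, hM⟩
    by_contra hne
    exact Nat.not_succ_le_zero _
      (hl ((RelSeries.singleton _ P).cons q (lt_of_le_of_ne hle hne)) (by simpa)
        (RelSeries.last_cons ..))
  | succ c ih =>
    intro M _ _ _ hP hM hl hM'
    obtain ⟨x, hx, hxq⟩ := exists_mem_forall_notMem_associatedPrimes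
      (notMem_associatedPrimes_of_uniformlyKilled (hM 0 (Nat.succ_pos c)))
    have hK := exists_notMem_smul_eq_zero hxq
    have hsupp := Module.support_quotSMulTop (M := M) x
    refine ih (QuotSMulTop x M) ?_ (fun i hi => ?_) (fun l h hlast => ?_) (fun j hj => ?_)
    · rw [hsupp]
      exact ⟨hP, by simpa using hx⟩
    · exact .quotSMulTop x hK (hM i (by lia)) (hM (i + 1) (by lia))
    · rw [hsupp] at h
      obtain ⟨q, hq, hle⟩ := exists_le_mem_associatedPrimes_of_mem_support h.1
      have hxl : x ∈ l.head.asIdeal := by simpa using h.2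
      have hlt : (⟨q, hq.isPrime⟩ : PrimeSpectrum R) < l.head := by
        refine lt_of_le_of_ne hle fun heq => ?_
        refine hxq q hq (hle.trans ?_) (by rw [← heq] at hxl; exact hxl)
        have h2 : l.head ≤ l.last := LTSeries.head_le_last l
        rwa [hlast] at h2
      have h3 := hl (l.cons _ hlt) (by
        rw [RelSeries.head_cons]
        refine Module.mem_support_iff_of_finite.2 ?_
        have := hq.annihilator_le
        rwa [Submodule.annihilator_top] at this) (by rwa [RelSeries.last_cons])
      simpa using h3
    · exact .quotSMulTop x hK (hM' j (by lia)) (hM' (j + 1) (by lia))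

omit hp in
lemma UniformlyKilled.of_support_isolated (P : PrimeSpectrum R) {j : ℕ}
    (h : UniformlyKilled P.asIdeal 𝓛 j (ModuleCat.of R (R ⧸ P.asIdeal))) (N : Type)
    [AddCommGroup N] [Module R N] [hN : Module.Finite R N]
    (hs : ∀ q ∈ Module.support R N, q ≤ P → q = P) :
    UniformlyKilled P.asIdeal 𝓛 j (ModuleCat.of R N) := by
  induction hN using IsNoetherianRing.induction_on_isQuotientEquivQuotientPrime with
  | subsingleton N => exact .of_smul P.2.one_notMem fun n => Subsingleton.elim (α := N) _ _
  | quotient N q f =>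
    by_cases hq : q ≤ P
    · have hqN : q ∈ Module.support R N := by
        rw [Module.mem_support_iff_of_finite, f.annihilator_eq, Ideal.annihilator_quotient]
      obtain rfl := hs q hqN hq
      obtain ⟨x, hx, H⟩ := h
      obtain ⟨φ⟩ : Nonempty (ModuleCat.of R N ≅ ModuleCat.of R (R ⧸ q.asIdeal)) :=
        ⟨f.toModuleIso⟩
      refine ⟨x, hx, fun X hX e => ?_⟩
      have h0 := H X hX (e.comp (Ext.mk₀ φ.hom) (add_zero j))
      rw [← Ext.smul_comp] at h0
      have h1 := congrArg (fun e' => e'.comp (Ext.mk₀ φ.inv) (add_zero j)) h0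
      simpa using h1
    · obtain ⟨x, hxq, hxP⟩ := Set.not_subset.1 hq
      refine .of_smul hxP fun (n : N) => f.injective ?_
      rw [map_smul, map_zero]
      obtain ⟨r, hr⟩ := Ideal.Quotient.mk_surjective (f n)
      rw [← hr]
      change Ideal.Quotient.mk q.asIdeal (x * r) = 0
      exact Ideal.Quotient.eq_zero_iff_mem.2 (Ideal.mul_mem_right _ _ hxq)
  | exact N₁ N₂ N₃ f g hf hg hfg h₁ h₃ =>
    have hsupp := Module.support_of_exact hfg hf hg
    exact .middle (shortExact_of_exact f g hf hfg hg)
      (h₁ fun q hq => hs q (hsupp ▸ Or.inl hq)) (h₃ fun q hq => hs q (hsupp ▸ Or.inr hq))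

theorem uniformlyKilled_quotient (P : PrimeSpectrum R) {e : ℕ} (hP : P ∈ Module.support R M)
    (hs : ∀ q ∈ Module.support R M, q ≤ P → q = P)
    (hM : ∀ j < e, UniformlyKilled P.asIdeal 𝓛 j (ModuleCat.of R M)) :
    ∀ j < e, UniformlyKilled P.asIdeal 𝓛 j (ModuleCat.of R (R ⧸ P.asIdeal)) := by
  obtain ⟨q, hq, hle⟩ := exists_le_mem_associatedPrimes_of_mem_support hP
  have h1 := hs ⟨q, hq.isPrime⟩ (by
    refine Module.mem_support_iff_of_finite.2 ?_
    have := hq.annihilator_le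
    rwa [Submodule.annihilator_top] at this) hle
  obtain rfl : q = P.asIdeal := congrArg PrimeSpectrum.asIdeal h1
  obtain ⟨-, f, hf⟩ := (isAssociatedPrime_iff_exists_injective_linearMap _ M).1 hq
  have hS := shortExact_of_exact f (LinearMap.range f).mkQ hf
    (by rw [LinearMap.exact_iff]; simp) (Submodule.mkQ_surjective _)
  intro j
  induction j with
  | zero => exact fun hj => .left_zero hS (hM 0 hj)
  | succ j ih =>
    intro hj
    exact .left hS (hM _ hj) (.of_support_isolated P (ih (by lia)) _
      fun q hq => hs q (Module.support_subset_of_surjective _ (Submodule.mkQ_surjective _) hq))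

end SupportReduction

section Dimension

variable {R : Type} [CommRing R]

lemma coheight_eq_ringKrullDim_quotient (I : Ideal R) :
    Paper.coheight R I = ringKrullDim (R ⧸ I) := by
  rw [ringKrullDim_quotient]
  exact Order.krullDim_eq_of_orderIso
    { toFun := fun q => ⟨⟨q.1, q.2.1⟩, q.2.2⟩
      invFun := fun q => ⟨q.1.1, q.1.2, q.2⟩
      left_inv := fun _ => rfl
      right_inv := fun _ => rfl
      map_rel_iff' := Iff.rfl }

lemma dimMod_eq_supportDim (M : Type) [AddCommGroup M] [Module R M] [Module.Finite R M] :
    Paper.dimMod R M = Module.supportDim R M := by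
  rw [Module.supportDim_eq_ringKrullDim_quotient_annihilator]
  exact coheight_eq_ringKrullDim_quotient _

lemma length_add_ringKrullDim_quotient_le (P : PrimeSpectrum R) {d e : ℕ}
    (hd : ringKrullDim R = d) (he : ringKrullDim (R ⧸ P.asIdeal) = e)
    (l : LTSeries (PrimeSpectrum R)) (hl : l.last = P) : l.length + e ≤ d := by
  rw [ringKrullDim_quotient] at he
  obtain ⟨l', rfl⟩ := Order.le_krullDim_iff.1 he.ge
  let Q : PrimeSpectrum R := l'.head
  have h1 : (l.length : ℕ∞) ≤ Order.height Q := Order.length_le_height (hl ▸ l'.head.2)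
  have h2 : (l'.length : ℕ∞) ≤ Order.coheight Q :=
    Order.length_le_coheight (p := l'.map Subtype.val fun _ _ h => h) le_rfl
  have h3 : ((Order.height Q + Order.coheight Q : ℕ∞) : WithBot ℕ∞) ≤ d := by
    have : Nonempty (PrimeSpectrum R) := ⟨P⟩
    rw [← hd, ringKrullDim, Order.krullDim_eq_iSup_height_add_coheight_of_nonempty]
    exact WithBot.coe_le_coe.2 (le_iSup (fun a => Order.height a + Order.coheight a) Q)
  have h4 := (WithBot.coe_le_coe.2 (add_le_add h1 h2)).trans h3
  exact_mod_cast h4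

end Dimension

/-- If the Noetherian local ring `R` is generalized Cohen–Macaulay, then `R/p` has a
uniform local cohomological annihilator for every prime `p`. -/
theorem hasULCAQuot_of_gCM (R : Type) [CommRing R] [IsNoetherianRing R] [IsLocalRing R]
    (hgcm : Paper.IsGCM R R) :
    ∀ (p : Ideal R), p.IsPrime → Paper.HasULCAQuot R p := by
  intro p hp
  by_cases hmp : IsLocalRing.maximalIdeal R ≤ p
  · have hpm := (IsLocalRing.maximalIdeal.isMaximal R).eq_of_le hp.ne_top hmp
    refine ⟨1, hp.one_notMem, fun i hi => ?_⟩
    rw [coheight_eq_ringKrullDim_quotient, ringKrullDim_eq_zero_of_isField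
      (Ideal.Quotient.maximal_ideal_iff_isField_quotient p |>.1 (hpm ▸
        IsLocalRing.maximalIdeal.isMaximal R))] at hi
    exact absurd hi (by simp)
  let P : PrimeSpectrum R := ⟨p, hp⟩
  have : IsLocalRing (R ⧸ p) := .of_surjective' _ Ideal.Quotient.mk_surjective
  obtain ⟨e, he⟩ : ∃ e : ℕ, ringKrullDim (R ⧸ p) = e :=
    ⟨_, Order.krullDim_eq_length_of_finiteDimensionalOrder⟩
  obtain ⟨d, hd⟩ : ∃ d : ℕ, ringKrullDim R = d :=
    ⟨_, Order.krullDim_eq_length_of_finiteDimensionalOrder⟩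
  have hed : e ≤ d := by
    have h := ringKrullDim_quotient_le p
    rw [he, hd] at h
    exact_mod_cast h
  obtain ⟨n, hn⟩ := hgcm
  rw [dimMod_eq_supportDim, Module.supportDim_self_eq_ringKrullDim, hd] at hn
  have h𝓣 : ∀ i < d, UniformlyKilled p (IsKilledByPow (IsLocalRing.maximalIdeal R)) i
      (ModuleCat.of R R) := by
    intro i hi
    refine uniformlyKilled_of_killedInLimit (IsNoetherian.noetherian _) i _ fun j hj => ?_
    obtain ⟨a, ha, hap⟩ := Set.not_subset.1 hmp
    exact ⟨a ^ n, fun h => hap (hp.mem_of_pow_mem n h), exists_smul_comp_eq_zero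
      (hn j (by exact_mod_cast hj.trans_lt hi) _ (Ideal.pow_mem_pow ha n))⟩
  have hfin := uniformlyKilled_of_finite h𝓣 (e + 1)
  have hsupp : P ∈ Module.support R R := Module.mem_support_iff_of_finite.2
    fun a ha => by simpa using congrArg (· ∈ p) (Module.mem_annihilator.1 ha (1 : R))
  obtain ⟨B, _, _, _, hPB, hB, hB'⟩ := exists_uniformlyKilled_of_isolated P (e := e)
    (d - e) R hsupp (fun i hi => (hfin i (by lia)).mono (by
      rintro _ rfl
      refine ⟨inferInstanceAs (Module.Finite R (R ⧸ p)), ?_⟩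
      change Module.supportDim R (R ⧸ p) < _
      rw [Module.supportDim_quotient_eq_ringKrullDim, he]
      exact_mod_cast Nat.lt_succ_self e))
    (fun l _ hl => Nat.le_sub_of_add_le (length_add_ringKrullDim_quotient_le P hd he l hl))
    (fun j hj => h𝓣 j (by lia))
  choose! x hx H using uniformlyKilled_quotient P hPB hB hB'
  refine ⟨∏ i ∈ Finset.range e, x i, fun h => ?_, fun i hi => ?_⟩
  · obtain ⟨i, hi, h⟩ := hp.prod_mem_iff.1 h
    exact hx i (Finset.mem_range.1 hi) h
  · rw [coheight_eq_ringKrullDim_quotient, he] at hi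
    have hi : i < e := by exact_mod_cast hi
    obtain ⟨y, hy⟩ := Finset.dvd_prod_of_mem x (Finset.mem_range.2 hi)
    rw [hy]
    refine smul_localCohomology_eq_zero fun t f => ?_
    rw [mul_comm, mul_smul, H i hi _ (isKilledByPow_quotPow _ t) f, smul_zero]
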